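/- arXiv:1407.3377 — 2 statements merged into one kernel-verified Lean document; each statement's English description precedes it below -/
import Mathlib

section
/- Let α be a linear order, n a natural number, and a : {0,…,n−1} → α an array. Then a satisfies the stretched-tree order (a(sp(j)) ≤ a(j) for all 1 ≤ j < n) if and only if a is a strong heap, i.e. a(⌊(j−1)/2⌋) ≤ a(j) for all 1 ≤ j < n and a(2i+1) ≤ a(2i+2) whenever 2i+2 < n. (In particular, the dominance arcs from a parent to its right child can be removed from a strong heap's dominance graph because they are induced by the remaining arcs.) -/
/-- The stretched-parent map: the parent of a left child (odd index) is its
binary-tree parent, and the parent of a right child (positive even index) is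
its left sibling; `sp 0 = 0`. -/
def sp (j : ℕ) : ℕ := if j % 2 = 1 then (j - 1) / 2 else j - 1

theorem sp_two_mul_add_one (i : ℕ) : sp (2 * i + 1) = i := by
  unfold sp
  split <;> omega

theorem sp_two_mul_add_two (i : ℕ) : sp (2 * i + 2) = 2 * i + 1 := by
  unfold sp
  split <;> omega

theorem Nat.exists_eq_left_or_right_child {j : ℕ} (hj : 1 ≤ j) :
    ∃ i, j = 2 * i + 1 ∨ j = 2 * i + 2 :=
  ⟨(j - 1) / 2, by omega⟩

/-- An array `a` on indices `0,…,n−1` satisfies the stretched-tree order iff it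
is a strong heap: every non-root node dominates its binary-tree parent, and
every right child dominates its left sibling. Thus the parent-to-right-child
dominance arcs are induced by the remaining arcs. -/
theorem stretched_order_iff_strong_heap {α : Type*} [LinearOrder α]
    (n : ℕ) (a : ℕ → α) :
    (∀ j : ℕ, 1 ≤ j → j < n → a (sp j) ≤ a j) ↔
      ((∀ j : ℕ, 1 ≤ j → j < n → a ((j - 1) / 2) ≤ a j) ∧
        (∀ i : ℕ, 2 * i + 2 < n → a (2 * i + 1) ≤ a (2 * i + 2))) := by
  constructor
  · intro h
    have left (i : ℕ) (hi : 2 * i + 1 < n) : a i ≤ a (2 * i + 1) := by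
      simpa only [sp_two_mul_add_one] using h (2 * i + 1) (by omega) hi
    have right (i : ℕ) (hi : 2 * i + 2 < n) : a (2 * i + 1) ≤ a (2 * i + 2) := by
      simpa only [sp_two_mul_add_two] using h (2 * i + 2) (by omega) hi
    refine ⟨fun j hj hjn => ?_, right⟩
    obtain ⟨i, rfl | rfl⟩ := Nat.exists_eq_left_or_right_child hj
    · rw [show (2 * i + 1 - 1) / 2 = i by omega]
      exact left i hjn
    · rw [show (2 * i + 2 - 1) / 2 = i by omega]
      exact (left i (by omega)).trans (right i hjn)
  · rintro ⟨heap, dom⟩ j hj hjn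
    obtain ⟨i, rfl | rfl⟩ := Nat.exists_eq_left_or_right_child hj
    · have h := heap (2 * i + 1) hj hjn
      rw [show (2 * i + 1 - 1) / 2 = i by omega] at h
      rwa [sp_two_mul_add_one]
    · rw [sp_two_mul_add_two]
      exact dom i hjn
end

section
/- Let α be a linear order and let a : {0,…,n−1} → α be a strong heap, i.e. a(⌊(j−1)/2⌋) ≤ a(j) for all 1 ≤ j < n and a(2i+1) ≤ a(2i+2) whenever 2i+2 < n. Then for every odd index i with i + 1 < n and every index j < n lying in the subtree rooted at the right sibling i + 1 (i.e. p^[m](j) = i + 1 for some m ≥ 0, where p(x) = ⌊(x−1)/2⌋), the element at the left child dominates: a(i) ≤ a(j). -/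
/-- The parent map of a binary heap stored in an array: `p x = ⌊(x−1)/2⌋`, with `p 0 = 0`. -/
def heapParent (x : ℕ) : ℕ := (x - 1) / 2

/-- In a heap, every element is bounded below by each of its ancestors. -/
theorem heap_iterate_parent_le {α : Type*} [Preorder α] {n : ℕ} {a : ℕ → α}
    (hheap : ∀ j : ℕ, 1 ≤ j → j < n → a ((j - 1) / 2) ≤ a j) (m : ℕ) :
    ∀ j : ℕ, j < n → a (heapParent^[m] j) ≤ a j := by
  induction m with
  | zero => exact fun j _ => le_rfl
  | succ m ih =>
    intro j hj
    rw [Function.iterate_succ_apply]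
    have hlt : heapParent j < n := by unfold heapParent; omega
    refine (ih _ hlt).trans ?_
    rcases Nat.eq_zero_or_pos j with rfl | hpos
    · exact le_rfl
    · exact hheap j hpos hj

/-- In a strong heap, the element at a left child `i` is dominated by every
element in the subtree rooted at its right sibling `i + 1`. -/
theorem strong_heap_left_dominates_right_subtree {α : Type*} [LinearOrder α]
    (n : ℕ) (a : ℕ → α)
    (hheap : ∀ j : ℕ, 1 ≤ j → j < n → a ((j - 1) / 2) ≤ a j)
    (hleft : ∀ i : ℕ, 2 * i + 2 < n → a (2 * i + 1) ≤ a (2 * i + 2)) :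
    ∀ i : ℕ, i % 2 = 1 → i + 1 < n →
      ∀ j : ℕ, j < n → (∃ m : ℕ, heapParent^[m] j = i + 1) → a i ≤ a j := by
  rintro i hi hin j hj ⟨m, hm⟩
  have hanc : a (i + 1) ≤ a j := hm ▸ heap_iterate_parent_le hheap m j hj
  obtain ⟨k, rfl⟩ : ∃ k, i = 2 * k + 1 := ⟨i / 2, by omega⟩
  exact (hleft k hin).trans hanc
end
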